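/- Enumeration of critical shortest paths: let G be a locally optimal geometric graph on ℤ², let u = (0,0) and v = (1,2), and suppose d_G(u,v) > 3+√2. Then any shortest walk in G from u to v (i.e., any walk from u to v whose Euclidean length equals d_G(u,v)) is, up to reversal and up to the point reflection σ(x,y) = (1−x, 2−y) of ℤ² (which exchanges u and v), one of the following four paths given by their vertex sequences: P₁ = (0,0),(−1,1),(−1,2),(0,3),(1,2); P₂ = (0,0),(−1,1),(0,2),(0,3),(1,2); P₃ = (0,0),(−1,1),(0,2),(1,3),(1,2); P₄ = (0,0),(1,0),(2,0),(2,1),(2,2),(1,2). -/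

import Mathlib

open SimpleGraph ENNReal

/-- The point of the Euclidean plane (identified with `ℂ`) corresponding to a lattice point. -/
noncomputable def toC (p : ℤ × ℤ) : ℂ := ⟨(p.1 : ℝ), (p.2 : ℝ)⟩

/-- The Euclidean length of a walk in a geometric graph on `ℤ²`:
the sum of the Euclidean lengths of its edges. -/
noncomputable def walkLen (G : SimpleGraph (ℤ × ℤ)) :
    ∀ {p q : ℤ × ℤ}, G.Walk p q → ℝ
  | _, _, .nil => 0
  | p, _, .cons (v := v) _ w => dist (toC p) (toC v) + walkLen G w

/-- The graph distance `d_G(p,q)`: infimum of Euclidean lengths of walks from `p` to `q`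
(`∞` if there is no walk). -/
noncomputable def gdist (G : SimpleGraph (ℤ × ℤ)) (p q : ℤ × ℤ) : ℝ≥0∞ :=
  ⨅ w : G.Walk p q, ENNReal.ofReal (walkLen G w)

/-- `G` has maximum degree at most `3`. -/
def MaxDegThree (G : SimpleGraph (ℤ × ℤ)) : Prop :=
  ∀ v : ℤ × ℤ, (G.neighborSet v).encard ≤ 3

/-- `G` is plane: two distinct edges, viewed as closed segments in the plane,
intersect at most in a common endpoint. -/
def IsPlane (G : SimpleGraph (ℤ × ℤ)) : Prop :=
  ∀ a b c d : ℤ × ℤ, G.Adj a b → G.Adj c d → s(a, b) ≠ s(c, d) →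
    ∀ x : ℂ, x ∈ segment ℝ (toC a) (toC b) → x ∈ segment ℝ (toC c) (toC d) →
      x ∈ ({toC a, toC b} : Set ℂ) ∧ x ∈ ({toC c, toC d} : Set ℂ)

/-- `G` is locally optimal. -/
def LocallyOptimal (G : SimpleGraph (ℤ × ℤ)) : Prop :=
  IsPlane G ∧ MaxDegThree G ∧
    ∀ p q : ℤ × ℤ, dist (toC p) (toC q) ≤ Real.sqrt 5 →
      gdist G p q ≤ ENNReal.ofReal ((1 + Real.sqrt 2) * dist (toC p) (toC q))

/-- The dilation of `G`. -/
noncomputable def dil (G : SimpleGraph (ℤ × ℤ)) : ℝ≥0∞ :=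
  ⨆ (p : ℤ × ℤ) (q : ℤ × ℤ) (_ : p ≠ q),
    gdist G p q / ENNReal.ofReal (dist (toC p) (toC q))

/-- The point reflection of ℤ² exchanging (0,0) and (1,2). -/
def σpt (p : ℤ × ℤ) : ℤ × ℤ := (1 - p.1, 2 - p.2)

def P1 : List (ℤ × ℤ) := [(0, 0), (-1, 1), (-1, 2), (0, 3), (1, 2)]
def P2 : List (ℤ × ℤ) := [(0, 0), (-1, 1), (0, 2), (0, 3), (1, 2)]
def P3 : List (ℤ × ℤ) := [(0, 0), (-1, 1), (0, 2), (1, 3), (1, 2)]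
def P4 : List (ℤ × ℤ) := [(0, 0), (1, 0), (2, 0), (2, 1), (2, 2), (1, 2)]

/-! ### Integer bounds for Euclidean lengths -/

/-- The squared Euclidean distance of two lattice points. -/
def sqDist (p q : ℤ × ℤ) : ℕ :=
  ((p.1 - q.1) * (p.1 - q.1) + (p.2 - q.2) * (p.2 - q.2)).toNat

/-- The integer parts of `1000 * √n` for `n < 30`. -/
def milliSqrt : List ℕ :=
  [0, 1000, 1414, 1732, 2000, 2236, 2449, 2645, 2828, 3000, 3162, 3316, 3464, 3605, 3741, 3872,
    4000, 4123, 4242, 4358, 4472, 4582, 4690, 4795, 4898, 5000, 5099, 5196, 5291, 5385]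

/-- A lower bound for `1000` times the distance of two lattice points. -/
def lowDist (p q : ℤ × ℤ) : ℕ := milliSqrt.getD (sqDist p q) 5477

/-- An upper bound for `1000` times the distance of two lattice points that are not too far
apart, exact for points at distance `1`. -/
def highDist (p q : ℤ × ℤ) : ℕ := if sqDist p q = 1 then 1000 else lowDist p q + 1

theorem dist_toC (p q : ℤ × ℤ) : dist (toC p) (toC q) = √(sqDist p q : ℝ) := by
  have h : ((sqDist p q : ℕ) : ℤ) = (p.1 - q.1) * (p.1 - q.1) + (p.2 - q.2) * (p.2 - q.2) :=
    Int.toNat_of_nonneg (add_nonneg (mul_self_nonneg _) (mul_self_nonneg _))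
  have h' : ((sqDist p q : ℕ) : ℝ)
      = ((p.1 : ℝ) - q.1) * (p.1 - q.1) + ((p.2 : ℝ) - q.2) * (p.2 - q.2) := by
    exact_mod_cast h
  rw [Complex.dist_eq_re_im, h']
  congr 1
  simp only [toC]
  ring

theorem milliSqrt_bounds :
    ∀ n < 30, milliSqrt.getD n 5477 ^ 2 ≤ 1000000 * n ∧
      1000000 * n ≤ (milliSqrt.getD n 5477 + 1) ^ 2 := by
  decide

theorem lowDist_le (p q : ℤ × ℤ) : (lowDist p q : ℝ) ≤ 1000 * dist (toC p) (toC q) := by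
  rw [dist_toC, lowDist]
  have h : milliSqrt.getD (sqDist p q) 5477 ^ 2 ≤ 1000000 * sqDist p q := by
    rcases lt_or_ge (sqDist p q) 30 with h | h
    · exact (milliSqrt_bounds _ h).1
    · rw [List.getD_eq_default _ _ (by simpa [milliSqrt] using h)]
      omega
  have h' : ((milliSqrt.getD (sqDist p q) 5477 : ℕ) : ℝ) ^ 2 ≤ 1000000 * sqDist p q := by
    exact_mod_cast h
  calc _ ≤ √(1000000 * (sqDist p q : ℝ)) := Real.le_sqrt_of_sq_le h'
    _ = 1000 * √(sqDist p q : ℝ) := by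
      rw [Real.sqrt_mul (by norm_num), show (1000000 : ℝ) = 1000 ^ 2 by norm_num,
        Real.sqrt_sq (by norm_num)]

theorem le_highDist {p q : ℤ × ℤ} (h : highDist p q ≤ 5477) :
    1000 * dist (toC p) (toC q) ≤ highDist p q := by
  rw [dist_toC]
  unfold highDist at h ⊢
  split_ifs at h ⊢ with h1
  · simp [h1]
  have hn : sqDist p q < 30 := by
    by_contra hn
    rw [lowDist, List.getD_eq_default _ _ (by simpa [milliSqrt] using hn)] at h
    omega
  have h' : (1000000 * sqDist p q : ℝ) ≤ ((lowDist p q + 1 : ℕ) : ℝ) ^ 2 := by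
    exact_mod_cast (milliSqrt_bounds _ hn).2
  calc 1000 * √(sqDist p q : ℝ) = √(1000000 * (sqDist p q : ℝ)) := by
        rw [Real.sqrt_mul (by norm_num), show (1000000 : ℝ) = 1000 ^ 2 by norm_num,
          Real.sqrt_sq (by norm_num)]
    _ ≤ _ := (Real.sqrt_le_left (Nat.cast_nonneg _)).2 h'

theorem one_le_dist_toC {p q : ℤ × ℤ} (h : p ≠ q) : 1 ≤ dist (toC p) (toC q) := by
  rw [dist_toC, Real.one_le_sqrt]
  have : 0 < sqDist p q := by
    rw [sqDist, Int.lt_toNat, Nat.cast_zero]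
    rcases eq_or_ne p.1 q.1 with h1 | h1
    · have h2 : p.2 - q.2 ≠ 0 := fun h2 => h (Prod.ext h1 (sub_eq_zero.mp h2))
      exact add_pos_of_nonneg_of_pos (mul_self_nonneg _) (mul_self_pos.2 h2)
    · exact add_pos_of_pos_of_nonneg (mul_self_pos.2 (sub_ne_zero.2 h1)) (mul_self_nonneg _)
  exact_mod_cast this

/-! ### Walks and their lengths -/

section Walks

variable {G : SimpleGraph (ℤ × ℤ)}

theorem walkLen_nonneg {p q : ℤ × ℤ} (w : G.Walk p q) : 0 ≤ walkLen G w := by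
  induction w with
  | nil => exact le_rfl
  | cons _ _ ih => exact add_nonneg dist_nonneg ih

theorem dist_le_walkLen {p q : ℤ × ℤ} (w : G.Walk p q) :
    dist (toC p) (toC q) ≤ walkLen G w := by
  induction w with
  | nil => simp [walkLen]
  | cons _ _ ih => exact (dist_triangle _ _ _).trans (add_le_add_right ih _)

theorem exists_walkLen_lt {p q : ℤ × ℤ} {c c' : ℝ} (h : gdist G p q ≤ ENNReal.ofReal c)
    (hc : c < c') (hc' : 0 < c') : ∃ w : G.Walk p q, walkLen G w < c' := by
  have h1 : gdist G p q < ENNReal.ofReal c' := h.trans_lt ((ENNReal.ofReal_lt_ofReal_iff hc').2 hc)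
  obtain ⟨w, hw⟩ := iInf_lt_iff.1 h1
  exact ⟨w, (ENNReal.ofReal_lt_ofReal_iff hc').1 hw⟩

/-- The edges of a walk given by its vertex sequence. -/
def edgesOf (l : List (ℤ × ℤ)) : List ((ℤ × ℤ) × (ℤ × ℤ)) := l.zip l.tail

theorem edgesOf_support_cons {p r q : ℤ × ℤ} (h : G.Adj p r) (w : G.Walk r q) :
    edgesOf (Walk.cons h w).support = (p, r) :: edgesOf w.support := by
  cases w <;> simp [edgesOf]

/-- All segments of the list `S` are edges of `G`. -/
def Realizes (G : SimpleGraph (ℤ × ℤ)) (S : List ((ℤ × ℤ) × (ℤ × ℤ))) : Prop :=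
  ∀ e ∈ S, G.Adj e.1 e.2

theorem realizes_edgesOf_support {p q : ℤ × ℤ} (w : G.Walk p q) :
    Realizes G (edgesOf w.support) := by
  induction w with
  | nil => simp [Realizes, edgesOf]
  | cons h w ih =>
    intro e he
    rw [edgesOf_support_cons, List.mem_cons] at he
    rcases he with rfl | he
    · exact h
    · exact ih e he

/-- A lower bound for `1000` times the length of a walk. -/
def lowLength (l : List (ℤ × ℤ)) : ℕ := ((edgesOf l).map fun e => lowDist e.1 e.2).sum

theorem lowLength_le {p q : ℤ × ℤ} (w : G.Walk p q) :
    (lowLength w.support : ℝ) ≤ 1000 * walkLen G w := by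
  induction w with
  | nil => simp [lowLength, edgesOf, walkLen]
  | @cons p r q h w ih =>
    have := lowDist_le p r
    rw [lowLength, edgesOf_support_cons, List.map_cons, List.sum_cons, ← lowLength, walkLen]
    push_cast
    linarith

/-! ### Local structure of locally optimal graphs -/

theorem exists_walkLen_lt_of_unit (hG : LocallyOptimal G) {p q : ℤ × ℤ} (h : sqDist p q = 1) :
    ∃ w : G.Walk p q, 1000 * walkLen G w ≤ 2415 := by
  have hd : dist (toC p) (toC q) = 1 := by simp [dist_toC, h]
  have h1 := hG.2.2 p q (by rw [hd, Real.one_le_sqrt]; norm_num)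
  have h2 : √2 < 1.415 := by rw [Real.sqrt_lt' (by norm_num)]; norm_num
  obtain ⟨w, hw⟩ := exists_walkLen_lt (c' := 2.415) h1 (by rw [hd]; linarith) (by norm_num)
  exact ⟨w, by linarith⟩

theorem exists_adj (hG : LocallyOptimal G) (p : ℤ × ℤ) : ∃ q, G.Adj p q := by
  have h : sqDist p (p.1 + 1, p.2) = 1 := by simp [sqDist]
  obtain ⟨w, -⟩ := exists_walkLen_lt_of_unit hG h
  generalize hq : (p.1 + 1, p.2) = q at w
  cases w with
  | nil => simpa using congrArg Prod.fst hq
  | cons h _ => exact ⟨_, h⟩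

theorem toC_injective : Function.Injective toC := by
  intro p q h
  have h1 := congrArg Complex.re h
  have h2 := congrArg Complex.im h
  simp only [toC, Int.cast_inj] at h1 h2
  exact Prod.ext h1 h2

theorem gcd_eq_one_of_adj (hG : LocallyOptimal G) {a b : ℤ × ℤ} (h : G.Adj a b) :
    Int.gcd (b.1 - a.1) (b.2 - a.2) = 1 := by
  by_contra hg
  set g := Int.gcd (b.1 - a.1) (b.2 - a.2) with hgdef
  have hg0 : g ≠ 0 := by
    intro h0
    rw [hgdef, Int.gcd_eq_zero_iff, sub_eq_zero, sub_eq_zero] at h0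
    exact h.ne (Prod.ext h0.1.symm h0.2.symm)
  have hg2 : (2 : ℝ) ≤ g := by exact_mod_cast (by omega : 2 ≤ g)
  obtain ⟨x, hx⟩ : (g : ℤ) ∣ b.1 - a.1 := Int.gcd_dvd_left ..
  obtain ⟨y, hy⟩ : (g : ℤ) ∣ b.2 - a.2 := Int.gcd_dvd_right ..
  have hx' : (b.1 : ℝ) - a.1 = g * x := by exact_mod_cast hx
  have hy' : (b.2 : ℝ) - a.2 = g * y := by exact_mod_cast hy
  have hxy : (x, y) ≠ (0, 0) := by
    intro h0
    simp only [Prod.mk.injEq] at h0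
    rw [h0.1, mul_zero, sub_eq_zero] at hx
    rw [h0.2, mul_zero, sub_eq_zero] at hy
    exact h.ne (Prod.ext hx.symm hy.symm)
  set m : ℤ × ℤ := (a.1 + x, a.2 + y) with hm
  have hma : m ≠ a := by
    intro h0
    have h1 := congrArg Prod.fst h0
    have h2 := congrArg Prod.snd h0
    simp only [hm, add_eq_left] at h1 h2
    exact hxy (Prod.ext h1 h2)
  have hmb : m ≠ b := by
    intro h0
    have h1 := congrArg Prod.fst h0
    have h2 := congrArg Prod.snd h0
    simp only [hm] at h1 h2
    have e1 : ((g : ℤ) - 1) * x = 0 := by linear_combination -hx - h1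
    have e2 : ((g : ℤ) - 1) * y = 0 := by linear_combination -hy - h2
    have hg1 : (g : ℤ) - 1 ≠ 0 := by omega
    exact hxy (Prod.ext ((mul_eq_zero.1 e1).resolve_left hg1)
      ((mul_eq_zero.1 e2).resolve_left hg1))
  have hseg : toC m ∈ segment ℝ (toC a) (toC b) := by
    refine ⟨1 - (g : ℝ)⁻¹, (g : ℝ)⁻¹, ?_, by positivity, by ring, ?_⟩
    · rw [sub_nonneg]
      exact inv_le_one_of_one_le₀ (by linarith)
    · have hg' : (g : ℝ) ≠ 0 := by positivity
      apply Complex.ext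
      · simp only [toC, hm, Complex.add_re, Complex.real_smul, Complex.re_ofReal_mul,
          Int.cast_add]
        field_simp
        linear_combination hx'
      · simp only [toC, hm, Complex.add_im, Complex.real_smul, Complex.im_ofReal_mul,
          Int.cast_add]
        field_simp
        linear_combination hy'
  obtain ⟨n, hn⟩ := exists_adj hG m
  have hne : s(a, b) ≠ s(m, n) := by
    intro h0
    have : m ∈ s(a, b) := h0 ▸ Sym2.mem_mk_left m n
    rcases Sym2.mem_iff.1 this with h1 | h1
    · exact hma h1
    · exact hmb h1
  rcases (hG.1 a b m n h hn hne (toC m) hseg (left_mem_segment ..)).1 with h1 | h1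
  · exact hma (toC_injective h1)
  · exact hmb (toC_injective h1)

/-! ### Enumeration of short walks -/

/-- The primitive lattice vectors with coordinates at most `5` in absolute value. -/
def primitiveSteps : List (ℤ × ℤ) :=
  (List.product [-5, -4, -3, -2, -1, 0, 1, 2, 3, 4, 5]
    [-5, -4, -3, -2, -1, 0, 1, 2, 3, 4, 5]).filter fun d => Int.gcd d.1 d.2 = 1

/-- The value `f n`, computed by the kernel with `n` in normal form. -/
def forceNat {α : Type*} (n : ℕ) (f : ℕ → α) : α :=
  match n with
  | 0 => f 0
  | k + 1 => f k.succ

theorem forceNat_eq {α : Type*} (n : ℕ) (f : ℕ → α) : forceNat n f = f n := by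
  cases n <;> rfl

/-- The value `f x`, computed by the kernel with `x` in normal form. -/
def forceInt {α : Type*} (x : ℤ) (f : ℤ → α) : α :=
  match x with
  | .ofNat n => forceNat n fun n => f (.ofNat n)
  | .negSucc n => forceNat n fun n => f (.negSucc n)

theorem forceInt_eq {α : Type*} (x : ℤ) (f : ℤ → α) : forceInt x f = f x := by
  cases x <;> simp [forceInt, forceNat_eq]

/-- The vertex sequences of the walks from `p` to `q` with primitive edges, at most `n` of them,
and of length at most `b / 1000`, together with some slightly longer ones. -/
def shortWalks : ℕ → ℤ × ℤ → ℤ × ℤ → ℕ → List (List (ℤ × ℤ))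
  | 0, p, q, _ => if p = q then [[p]] else []
  | n + 1, p, q, b =>
    (if p = q then [[p]] else []) ++ primitiveSteps.flatMap fun d =>
      forceInt (p.1 + d.1) fun x => forceInt (p.2 + d.2) fun y =>
      forceNat (lowDist p (x, y)) fun c =>
      if c + lowDist (x, y) q ≤ b then
        forceNat (b - c) fun b' => (shortWalks n (x, y) q b').map (p :: ·)
      else []

theorem mem_primitiveSteps (hG : LocallyOptimal G) {p q : ℤ × ℤ} (h : G.Adj p q)
    (hpq : lowDist p q < 5477) : (q.1 - p.1, q.2 - p.2) ∈ primitiveSteps := by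
  have hn : sqDist p q < 30 := by
    by_contra hn
    rw [lowDist, List.getD_eq_default _ _ (by simpa [milliSqrt] using hn)] at hpq
    omega
  rw [sqDist] at hn
  have hn' : (p.1 - q.1) * (p.1 - q.1) + (p.2 - q.2) * (p.2 - q.2) < 30 := by omega
  have key : ∀ x : ℤ, x * x < 30 → -x ∈ ([-5, -4, -3, -2, -1, 0, 1, 2, 3, 4, 5] : List ℤ) := by
    intro x hx
    have h1 : x ≤ 5 := by nlinarith
    have h2 : -5 ≤ x := by nlinarith
    interval_cases x <;> simp
  have h1 := key (p.1 - q.1) (by nlinarith [mul_self_nonneg (p.2 - q.2)])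
  have h2 := key (p.2 - q.2) (by nlinarith [mul_self_nonneg (p.1 - q.1)])
  rw [neg_sub] at h1 h2
  exact List.mem_filter.2 ⟨List.mem_product.2 ⟨h1, h2⟩, by simpa using gcd_eq_one_of_adj hG h⟩

theorem support_mem_shortWalks (hG : LocallyOptimal G) (n : ℕ) {p q : ℤ × ℤ} (w : G.Walk p q)
    (b : ℕ) (hb : b < 1000 * (n + 1)) (hb' : b < 5477) (hw : 1000 * walkLen G w ≤ b) :
    w.support ∈ shortWalks n p q b := by
  induction w generalizing n b with
  | nil => cases n <;> simp [shortWalks]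
  | @cons p r q h w ih =>
    have hpos := walkLen_nonneg w
    have hone := one_le_dist_toC h.ne
    rw [walkLen] at hw
    cases n with
    | zero =>
      exfalso
      have : (b : ℝ) < 1000 := by exact_mod_cast hb
      linarith
    | succ n =>
      have h1 := lowDist_le p r
      have h2 := lowDist_le r q
      have h3 := dist_le_walkLen w
      have hle : lowDist p r + lowDist r q ≤ b := by
        have : ((lowDist p r + lowDist r q : ℕ) : ℝ) ≤ b := by push_cast; linarith
        exact_mod_cast this
      have h1000 : 1000 ≤ lowDist p r := by
        have hs : sqDist p r ≠ 0 := by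
          intro hs
          rw [dist_toC, hs] at hone
          norm_num at hone
        have key : ∀ k < 30, k ≠ 0 → 1000 ≤ milliSqrt.getD k 5477 := by decide
        rw [lowDist]
        rcases lt_or_ge (sqDist p r) 30 with hk | hk
        · exact key _ hk hs
        · rw [List.getD_eq_default _ _ (by simpa [milliSqrt] using hk)]
          norm_num
      have hmem := ih n (b - lowDist p r) (by omega) (by omega) (by
        rw [Nat.cast_sub (by omega)]
        linarith)
      simp only [shortWalks, forceInt_eq, forceNat_eq]
      rw [List.mem_append, List.mem_flatMap]
      refine Or.inr ⟨_, mem_primitiveSteps hG h (by omega), ?_⟩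
      simp only [add_sub_cancel, Prod.mk.eta, if_pos hle, Walk.support_cons, List.mem_map]
      exact ⟨_, hmem, rfl⟩

/-! ### Configurations that cannot occur -/

/-- Twice the signed area of the triangle `abc`. -/
def orient (a b c : ℤ × ℤ) : ℤ :=
  (b.1 - a.1) * (c.2 - a.2) - (b.2 - a.2) * (c.1 - a.1)

/-- The segments `e` and `f` cross at an interior point of both. -/
def Crosses (e f : (ℤ × ℤ) × (ℤ × ℤ)) : Bool :=
  orient e.1 e.2 f.1 * orient e.1 e.2 f.2 < 0 && orient f.1 f.2 e.1 * orient f.1 f.2 e.2 < 0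

theorem div_sub_mem_Ioo {x y : ℝ} (h : x * y < 0) : 0 < x / (x - y) ∧ x / (x - y) < 1 := by
  rcases mul_neg_iff.1 h with ⟨hx, hy⟩ | ⟨hx, hy⟩
  · exact ⟨div_pos hx (by linarith), (div_lt_one (by linarith)).2 (by linarith)⟩
  · exact ⟨div_pos_of_neg_of_neg hx (by linarith),
      (div_lt_one_of_neg (by linarith)).2 (by linarith)⟩

theorem not_crosses (hG : IsPlane G) {e f : (ℤ × ℤ) × (ℤ × ℤ)} (he : G.Adj e.1 e.2)
    (hf : G.Adj f.1 f.2) : ¬ Crosses e f := by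
  obtain ⟨a, b⟩ := e
  obtain ⟨c, d⟩ := f
  intro h
  simp only [Crosses, Bool.and_eq_true, decide_eq_true_eq] at h
  obtain ⟨h1, h2⟩ := h
  have hne : s(a, b) ≠ s(c, d) := by
    intro h0
    have : a ∈ s(c, d) := h0 ▸ Sym2.mem_mk_left a b
    rcases Sym2.mem_iff.1 this with rfl | rfl
    · simp [orient] at h1
    · simp [orient, mul_comm] at h1
  have h1' : (orient a b c : ℝ) * orient a b d < 0 := by exact_mod_cast h1
  have h2' : (orient c d a : ℝ) * orient c d b < 0 := by exact_mod_cast h2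
  have e1 : (orient a b c : ℝ) - orient a b d ≠ 0 := by
    intro h0
    rw [sub_eq_zero.1 h0] at h1'
    exact absurd h1' (not_lt.2 (mul_self_nonneg _))
  have e2 : (orient c d a : ℝ) - orient c d b ≠ 0 := by
    intro h0
    rw [sub_eq_zero.1 h0] at h2'
    exact absurd h2' (not_lt.2 (mul_self_nonneg _))
  obtain ⟨s1, s2⟩ := div_sub_mem_Ioo h1'
  obtain ⟨t1, t2⟩ := div_sub_mem_Ioo h2'
  set s := (orient a b c : ℝ) / (orient a b c - orient a b d) with hs
  set t := (orient c d a : ℝ) / (orient c d a - orient c d b) with ht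
  have hx : (1 - t) • toC a + t • toC b = (1 - s) • toC c + s • toC d := by
    rw [hs, ht]
    simp only [orient] at e1 e2 ⊢
    push_cast at e1 e2 ⊢
    apply Complex.ext
    · simp only [toC, Complex.add_re, Complex.real_smul, Complex.re_ofReal_mul]
      field_simp
      ring
    · simp only [toC, Complex.add_im, Complex.real_smul, Complex.im_ofReal_mul]
      field_simp
      ring
  have hab : (1 - t) • toC a + t • toC b ∈ segment ℝ (toC a) (toC b) :=
    ⟨1 - t, t, by linarith, by linarith, by ring, rfl⟩
  have hcd : (1 - t) • toC a + t • toC b ∈ segment ℝ (toC c) (toC d) :=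
    ⟨1 - s, s, by linarith, by linarith, by ring, hx.symm⟩
  have hne' : toC b - toC a ≠ 0 := fun h0 => he.ne (toC_injective (sub_eq_zero.1 h0)).symm
  rcases (hG a b c d he hf hne _ hab hcd).1 with h0 | h0
  · have : t • (toC b - toC a) = 0 := by
      rw [← sub_eq_zero.2 h0]
      module
    exact (smul_ne_zero t1.ne' hne') this
  · have : (1 - t) • (toC b - toC a) = 0 := by
      rw [← neg_eq_zero, ← sub_eq_zero.2 (Set.mem_singleton_iff.1 h0)]
      module
    exact (smul_ne_zero (sub_pos.2 t2).ne' hne') this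

/-- The other endpoints of the segments of `S` with endpoint `p`. -/
def partners (S : List ((ℤ × ℤ) × (ℤ × ℤ))) (p : ℤ × ℤ) : List (ℤ × ℤ) :=
  S.filterMap fun e => if e.1 = p then some e.2 else if e.2 = p then some e.1 else none

theorem adj_of_mem_partners {S : List ((ℤ × ℤ) × (ℤ × ℤ))} (hS : Realizes G S) {p q : ℤ × ℤ}
    (h : q ∈ partners S p) : G.Adj p q := by
  obtain ⟨e, he, h⟩ := List.mem_filterMap.1 h
  have := hS e he
  split_ifs at h with h1 h2
  · cases h
    exact h1 ▸ this
  · cases h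
    exact h2 ▸ this.symm

theorem length_dedup_partners_le (hG : MaxDegThree G) {S : List ((ℤ × ℤ) × (ℤ × ℤ))}
    (hS : Realizes G S) (p : ℤ × ℤ) : (partners S p).dedup.length ≤ 3 := by
  have h : ((partners S p).toFinset : Set (ℤ × ℤ)) ⊆ G.neighborSet p := fun q hq =>
    adj_of_mem_partners hS (List.mem_toFinset.1 hq)
  have h1 := (Set.encard_le_encard h).trans (hG p)
  rw [Set.encard_coe_eq_coe_finsetCard, List.card_toFinset] at h1
  exact_mod_cast h1

/-- The segments of `S` contain a walk from `p` to `q` with at most `n` edges and of length at most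
`b / 1000`, as certified by `highDist`. -/
def reaches (S : List ((ℤ × ℤ) × (ℤ × ℤ))) (q : ℤ × ℤ) : ℕ → ℤ × ℤ → ℕ → Bool
  | 0, p, _ => p = q
  | n + 1, p, b => p = q || (partners S p).any fun r =>
      forceNat (highDist p r) fun c => c ≤ b && forceNat (b - c) (reaches S q n r)

theorem exists_walk_of_reaches {S : List ((ℤ × ℤ) × (ℤ × ℤ))} (hS : Realizes G S) {q : ℤ × ℤ}
    (n : ℕ) {p : ℤ × ℤ} {b : ℕ} (hb : b ≤ 5477) (h : reaches S q n p b) :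
    ∃ w : G.Walk p q, 1000 * walkLen G w ≤ b := by
  have hnil : ∀ p b, p = q → ∃ w : G.Walk p q, 1000 * walkLen G w ≤ (b : ℕ) := by
    rintro p b rfl
    exact ⟨Walk.nil, by simp [walkLen]⟩
  induction n generalizing p b with
  | zero => exact hnil p b (by simpa [reaches] using h)
  | succ n ih =>
    simp only [reaches, forceNat_eq, Bool.or_eq_true, decide_eq_true_eq, List.any_eq_true,
      Bool.and_eq_true] at h
    rcases h with h | ⟨r, hr, hle, h⟩
    · exact hnil p b h
    · obtain ⟨w, hw⟩ := ih (by omega) h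
      refine ⟨Walk.cons (adj_of_mem_partners hS hr) w, ?_⟩
      have := le_highDist (hle.trans hb)
      rw [Nat.cast_sub hle] at hw
      rw [walkLen]
      linarith

/-- The segments `S` cannot all be edges of a locally optimal graph in which every walk from
`(0, 0)` to `(1, 2)` is longer than `b / 1000`, for a reason that involves the segments `N`. -/
def conflict (b : ℕ) (N S : List ((ℤ × ℤ) × (ℤ × ℤ))) : Bool :=
  N.any (fun e => S.any (Crosses e)) ||
  N.any (fun e => 3 < (partners S e.1).dedup.length || 3 < (partners S e.2).dedup.length) ||
  reaches S (1, 2) 5 (0, 0) b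

/-- Some pairs of points at distance `1`. -/
def unitPairs : List ((ℤ × ℤ) × (ℤ × ℤ)) :=
  [((0, 1), (0, 2)), ((1, 0), (1, 1)), ((-1, 2), (0, 2)), ((1, 0), (2, 0)), ((0, 0), (0, 1)),
    ((0, 0), (1, 0)), ((0, 2), (1, 2)), ((1, 1), (1, 2)), ((-2, 2), (-1, 2)), ((2, 1), (3, 1)),
    ((0, 3), (0, 4)), ((1, -2), (1, -1)), ((2, 0), (2, 1)), ((0, 1), (1, 1)), ((0, 2), (0, 3)),
    ((-1, 1), (-1, 2))]

/-- The vertex sequences of the walks of length at most `1 + √2` between the points `p` and `q` at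
distance `1`. -/
def detours (p q : ℤ × ℤ) : List (List (ℤ × ℤ)) :=
  [[p, q],
    [p, (p.1 + (q.2 - p.2), p.2 - (q.1 - p.1)), q],
    [p, (p.1 - (q.2 - p.2), p.2 + (q.1 - p.1)), q],
    [p, (q.1 + (q.2 - p.2), q.2 - (q.1 - p.1)), q],
    [p, (q.1 - (q.2 - p.2), q.2 + (q.1 - p.1)), q]]

/-- A search of depth `n`, over the ways in which the points of `unitPairs` may be connected, for a
proof that the segments `S` lead to a `conflict`. -/
def refute (b : ℕ) : ℕ → List ((ℤ × ℤ) × (ℤ × ℤ)) → List ((ℤ × ℤ) × (ℤ × ℤ)) → Bool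
  | 0, N, S => conflict b N S
  | n + 1, N, S => conflict b N S || unitPairs.any fun e =>
      (detours e.1 e.2).all fun l => refute b n (edgesOf l) (edgesOf l ++ S)

theorem shortWalks_unitPairs :
    ∀ e ∈ unitPairs, sqDist e.1 e.2 = 1 ∧
      ∀ l ∈ shortWalks 2 e.1 e.2 2415, l ∈ detours e.1 e.2 := by
  decide +kernel

theorem not_refute (hG : LocallyOptimal G) {b : ℕ} (hb : b ≤ 5477)
    (hfar : ∀ w : G.Walk (0, 0) (1, 2), (b : ℝ) < 1000 * walkLen G w) (n : ℕ)
    {N S : List ((ℤ × ℤ) × (ℤ × ℤ))} (hNS : N ⊆ S) (hS : Realizes G S) :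
    ¬ refute b n N S := by
  have hc : ∀ {N S : List ((ℤ × ℤ) × (ℤ × ℤ))}, N ⊆ S → Realizes G S → ¬ conflict b N S := by
    intro N S hNS hS h
    simp only [conflict, Bool.or_eq_true, List.any_eq_true, decide_eq_true_eq] at h
    rcases h with (⟨e, he, f, hf, h⟩ | ⟨e, he, h | h⟩) | h
    · exact not_crosses hG.1 (hS e (hNS he)) (hS f hf) h
    · exact absurd h (not_lt.2 (length_dedup_partners_le hG.2.1 hS _))
    · exact absurd h (not_lt.2 (length_dedup_partners_le hG.2.1 hS _))
    · obtain ⟨w, hw⟩ := exists_walk_of_reaches hS 5 hb h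
      exact absurd (hfar w) (not_lt.2 hw)
  induction n generalizing N S with
  | zero => exact hc hNS hS
  | succ n ih =>
    intro h
    rw [refute, Bool.or_eq_true, List.any_eq_true] at h
    rcases h with h | ⟨e, he, h⟩
    · exact hc hNS hS h
    · obtain ⟨h1, h2⟩ := shortWalks_unitPairs e he
      obtain ⟨w, hw⟩ := exists_walkLen_lt_of_unit hG h1
      have hw' := h2 _ (support_mem_shortWalks hG 2 w 2415 (by norm_num) (by norm_num)
        (by exact_mod_cast hw))
      refine ih (List.subset_append_left _ _) ?_ (List.all_eq_true.1 h _ hw')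
      intro f hf
      rcases List.mem_append.1 hf with hf | hf
      · exact realizes_edgesOf_support w f hf
      · exact hS f hf

/-! ### Walks of length at most `3 + √2` -/

/-- The number of edges of length `√2` of a walk. -/
def numDiagonals (l : List (ℤ × ℤ)) : ℕ := (edgesOf l).countP fun e => sqDist e.1 e.2 = 2

/-- An upper bound for `1000` times the length of a walk without its edges of length `√2`. -/
def highRest (l : List (ℤ × ℤ)) : ℕ :=
  ((edgesOf l).map fun e => if sqDist e.1 e.2 = 2 then 0 else highDist e.1 e.2).sum

/-- A certificate, checked with integers, that a walk has length at most `3 + √2`. -/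
def isNear (l : List (ℤ × ℤ)) : Bool :=
  (numDiagonals l = 0 && highRest l ≤ 4414) ||
  (1 ≤ numDiagonals l && highRest l + 1415 * (numDiagonals l - 1) ≤ 3000)

theorem walkLen_le_highRest {p q : ℤ × ℤ} (w : G.Walk p q) (hle : highRest w.support ≤ 5477) :
    1000 * walkLen G w ≤ highRest w.support + 1000 * √2 * numDiagonals w.support := by
  induction w with
  | nil => simp [walkLen, edgesOf, highRest, numDiagonals]
  | @cons p r q h w ih =>
    have h1 : highRest (Walk.cons h w).support
        = (if sqDist p r = 2 then 0 else highDist p r) + highRest w.support := by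
      rw [highRest, edgesOf_support_cons, List.map_cons, List.sum_cons, ← highRest]
    have h2 : numDiagonals (Walk.cons h w).support
        = numDiagonals w.support + if sqDist p r = 2 then 1 else 0 := by
      rw [numDiagonals, edgesOf_support_cons, List.countP_cons, ← numDiagonals]
      simp
    rw [h1] at hle
    rw [h1, h2, walkLen]
    have := ih (by omega)
    split_ifs at hle ⊢ with hpr
    · rw [dist_toC, hpr]
      push_cast
      linarith
    · have := le_highDist (p := p) (q := r) (by omega)
      push_cast
      linarith

theorem walkLen_le_of_isNear {p q : ℤ × ℤ} (w : G.Walk p q) (h : isNear w.support) :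
    walkLen G w ≤ 3 + √2 := by
  have l1 : 1.4142 < √2 := Real.lt_sqrt_of_sq_lt (by norm_num)
  have l2 : √2 < 1.415 := by rw [Real.sqrt_lt' (by norm_num)]; norm_num
  simp only [isNear, Bool.or_eq_true, Bool.and_eq_true, decide_eq_true_eq] at h
  have key := walkLen_le_highRest w (by omega)
  rcases h with ⟨h1, h2⟩ | ⟨h1, h2⟩
  · have h3 : (highRest w.support : ℝ) ≤ 4414 := by exact_mod_cast h2
    rw [h1, Nat.cast_zero] at key
    linarith
  · obtain ⟨k, hk⟩ := Nat.exists_eq_add_of_le' h1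
    rw [hk, Nat.add_sub_cancel] at h2
    have h3 : (highRest w.support : ℝ) + 1415 * k ≤ 3000 := by exact_mod_cast h2
    have h4 : 1000 * √2 * k ≤ 1415 * k := by gcongr; linarith
    rw [hk] at key
    push_cast at key
    linarith

end Walks

/-- Every candidate for a shortest walk from `(0, 0)` to `(1, 2)` is too short, is refuted, or is
one of the critical paths. -/
theorem shortWalks_critical :
    ∀ l ∈ shortWalks 5 (0, 0) (1, 2) 5399, isNear l ∨
      refute (lowLength l - 1) 0 (edgesOf l) (edgesOf l) ∨
      (∃ L ∈ [P1, P2, P3, P4],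
        l = L ∨ l = L.reverse ∨ l = L.map σpt ∨ l = (L.map σpt).reverse) ∨
      refute (lowLength l - 1) 1 [] (edgesOf l) ∨ refute (lowLength l - 1) 2 [] (edgesOf l) := by
  decide +kernel

/-- Enumeration of critical shortest paths: if G is locally optimal and
d_G((0,0),(1,2)) > 3+√2, then any shortest walk from (0,0) to (1,2) is, up to
reversal and up to the point reflection σ, one of P₁, P₂, P₃, P₄. -/
theorem shortest_path_enumeration (G : SimpleGraph (ℤ × ℤ)) (hG : LocallyOptimal G)
    (hfar : ENNReal.ofReal (3 + Real.sqrt 2) < gdist G (0, 0) (1, 2))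
    (w : G.Walk (0, 0) (1, 2))
    (hw : ENNReal.ofReal (walkLen G w) = gdist G (0, 0) (1, 2)) :
    ∃ L ∈ [P1, P2, P3, P4],
      w.support = L ∨ w.support = L.reverse ∨
      w.support = L.map σpt ∨ w.support = (L.map σpt).reverse := by
  have hle : ∀ w' : G.Walk (0, 0) (1, 2), walkLen G w ≤ walkLen G w' := fun w' =>
    (ENNReal.ofReal_le_ofReal_iff (walkLen_nonneg w')).1 (hw.trans_le (iInf_le _ w'))
  have hd : dist (toC (0, 0)) (toC (1, 2)) = √5 := by
    simp [dist_toC, sqDist]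
  have l2 : √2 < 1.41422 := by rw [Real.sqrt_lt' (by norm_num)]; norm_num
  have l5 : √5 < 2.23607 := by rw [Real.sqrt_lt' (by norm_num)]; norm_num
  have hup : 1000 * walkLen G w ≤ (5399 : ℕ) := by
    have h := hG.2.2 (0, 0) (1, 2) hd.le
    rw [← hw, ENNReal.ofReal_le_ofReal_iff (by positivity), hd] at h
    have : (1 + √2) * √5 ≤ 2.41422 * 2.23607 := by gcongr; linarith
    push_cast
    linarith
  have hfar' : ¬ isNear w.support := fun h =>
    absurd hfar (not_lt.2 (hw ▸ ENNReal.ofReal_le_ofReal (walkLen_le_of_isNear w h)))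
  have hlow := lowLength_le w
  have hlt : ∀ w' : G.Walk (0, 0) (1, 2),
      ((lowLength w.support - 1 : ℕ) : ℝ) < 1000 * walkLen G w' := by
    intro w'
    have h1 := hle w'
    have h2 := dist_le_walkLen w'
    have h3 : (0 : ℝ) < √5 := by positivity
    rcases Nat.eq_zero_or_pos (lowLength w.support) with h | h
    · rw [h, Nat.zero_sub, Nat.cast_zero]
      linarith
    · rw [Nat.cast_sub h]
      push_cast
      linarith
  have hlow' : lowLength w.support - 1 ≤ 5477 := by
    have : lowLength w.support ≤ 5399 := by exact_mod_cast hlow.trans hup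
    omega
  have hS := realizes_edgesOf_support w
  rcases shortWalks_critical _ (support_mem_shortWalks hG 5 w 5399 (by norm_num) (by norm_num) hup)
    with h | h | h | h | h
  · exact absurd h hfar'
  · exact absurd h (not_refute hG hlow' hlt 0 (List.Subset.refl _) hS)
  · exact h
  · exact absurd h (not_refute hG hlow' hlt 1 (List.nil_subset _) hS)
  · exact absurd h (not_refute hG hlow' hlt 2 (List.nil_subset _) hS)
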